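/- Suppose S is smooth and 1 ≤ p < n. Then there exists a nonempty Zariski open subset U of ℂ^{(n−p)×n} such that for every a ∈ U all submatrices a^{(i)} (1 ≤ i ≤ n−p) have maximal rank n−p−i+1 and, for every 1 ≤ i < n−p, the sets Δ_i and \barΔ_i are empty or closed subvarieties of the polar varieties W_{K(\underline{a^{(i)}})}(S) and W_{\bar K(\bar{a^{(i)}})}(S) of codimension at least 2, respectively. -/

import Mathlib

open MvPolynomial

noncomputable section

/-- The Zariski closure of a subset of the affine space `σ → ℂ`. -/
def zcl {σ : Type} (T : Set (σ → ℂ)) : Set (σ → ℂ) :=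
  MvPolynomial.zeroLocus ℂ (MvPolynomial.vanishingIdeal ℂ T)

/-- Zariski open subsets of the affine space `σ → ℂ`. -/
def ZOpen {σ : Type} (U : Set (σ → ℂ)) : Prop :=
  ∃ I : Ideal (MvPolynomial σ ℂ), U = {x | ∃ f ∈ I, MvPolynomial.eval x f ≠ 0}

/-- Zariski open subsets of the space of `m × n` complex matrices. -/
def ZOpenMat {m n : ℕ} (U : Set (Matrix (Fin m) (Fin n) ℂ)) : Prop :=
  ∃ I : Ideal (MvPolynomial (Fin m × Fin n) ℂ),
    U = {a | ∃ f ∈ I, MvPolynomial.eval (fun q => a q.1 q.2) f ≠ 0}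

/-- `T` is of pure dimension `d`: every irreducible component of (the Zariski closure of) `T`,
i.e. every minimal prime over its vanishing ideal, has coordinate ring of Krull dimension `d`. -/
def IsPureDim {σ : Type} (T : Set (σ → ℂ)) (d : ℕ) : Prop :=
  ∀ P ∈ (MvPolynomial.vanishingIdeal ℂ T).minimalPrimes,
    ringKrullDim (MvPolynomial σ ℂ ⧸ P) = (d : WithBot (WithTop ℕ))

/-- The Zariski tangent space at a point `x` of (the Zariski closure of) a subset `T`
of affine space: the common kernel of the differentials at `x` of all polynomials
vanishing on `T`. -/
def tangentAt {σ : Type} [Fintype σ] [DecidableEq σ] (T : Set (σ → ℂ)) (x : σ → ℂ) :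
    Submodule ℂ (σ → ℂ) :=
  ⨅ (f : MvPolynomial σ ℂ) (_ : f ∈ MvPolynomial.vanishingIdeal ℂ T),
    LinearMap.ker
      (∑ l, MvPolynomial.eval x (MvPolynomial.pderiv l f) •
        (LinearMap.proj l : (σ → ℂ) →ₗ[ℂ] ℂ))

/-- `rs` is a regular sequence in the commutative ring `R`. -/
def IsRegSeq {R : Type*} [CommRing R] (rs : List R) : Prop :=
  Ideal.span {x | x ∈ rs} ≠ ⊤ ∧
  ∀ j, j < rs.length → ∀ b : R,
    rs.getD j 0 * b ∈ Ideal.span {x | x ∈ rs.take j} →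
    b ∈ Ideal.span {x | x ∈ rs.take j}

/-- The common zero set in `ℂⁿ` of polynomials `F₁, …, F_p ∈ ℚ[X₁, …, Xₙ]`. -/
def zeroSetC {n p : ℕ} (F : Fin p → MvPolynomial (Fin n) ℚ) : Set (Fin n → ℂ) :=
  {x | ∀ k, MvPolynomial.aeval x (F k) = 0}

/-- The Jacobian matrix `[∂F_k/∂X_l]` evaluated at `x ∈ ℂⁿ`. -/
def jacC {n p : ℕ} (F : Fin p → MvPolynomial (Fin n) ℚ) (x : Fin n → ℂ) :
    Matrix (Fin p) (Fin n) ℂ :=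
  Matrix.of fun k l => MvPolynomial.aeval x (MvPolynomial.pderiv l (F k))

/-- The set of regular points of `S = {F₁ = 0, …, F_p = 0}`: points of `S` where the
Jacobian has maximal rank `p`. -/
def SregC {n p : ℕ} (F : Fin p → MvPolynomial (Fin n) ℚ) : Set (Fin n → ℂ) :=
  {x | x ∈ zeroSetC F ∧ (jacC F x).rank = p}

/-- The classic polar variety: the Zariski closure of the locus of regular points of `S`
where the matrix obtained by appending the rows of `a` to the Jacobian has rank at
most `r` (i.e. where all `(r+1)`-minors vanish). -/
def Wclassic {n p m : ℕ} (F : Fin p → MvPolynomial (Fin n) ℚ)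
    (a : Matrix (Fin m) (Fin n) ℂ) (r : ℕ) : Set (Fin n → ℂ) :=
  zcl {x | x ∈ SregC F ∧ (Matrix.fromRows (jacC F x) a).rank ≤ r}

/-- The dual polar variety: as `Wclassic`, with appended rows `(a_{k,1} - X₁, …, a_{k,n} - Xₙ)`. -/
def Wdual {n p m : ℕ} (F : Fin p → MvPolynomial (Fin n) ℚ)
    (a : Matrix (Fin m) (Fin n) ℂ) (r : ℕ) : Set (Fin n → ℂ) :=
  zcl {x | x ∈ SregC F ∧
    (Matrix.fromRows (jacC F x) (Matrix.of fun k l => a k l - x l)).rank ≤ r}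

/-- `F₁, …, F_p` generate the full vanishing ideal of their zero set (over `ℂ`);
this encodes that `(F₁, …, F_p)` is reduced (radical) and the ideal of definition of `S`. -/
def idealOfDef {n p : ℕ} (F : Fin p → MvPolynomial (Fin n) ℚ) : Prop :=
  MvPolynomial.vanishingIdeal ℂ (zeroSetC F) =
    Ideal.span (Set.range fun k => MvPolynomial.map (algebraMap ℚ ℂ) (F k))

/-- The submatrix of the first `m` rows of a matrix. -/
def firstRows {N n' m : ℕ} (a : Matrix (Fin N) (Fin n') ℂ) (h : m ≤ N) :
    Matrix (Fin m) (Fin n') ℂ :=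
  Matrix.of fun k l => a (Fin.castLE h k) l

/-- The matrix obtained by deleting row `h`. -/
def rowErase {m n' : ℕ} (a : Matrix (Fin (m + 1)) (Fin n') ℂ) (h : Fin (m + 1)) :
    Matrix (Fin m) (Fin n') ℂ :=
  Matrix.of fun k l => a (h.succAbove k) l

/-- The real trace `S_ℝ := S ∩ ℝⁿ`, as a subset of Euclidean space. -/
def SR {n p : ℕ} (F : Fin p → MvPolynomial (Fin n) ℚ) : Set (EuclideanSpace ℝ (Fin n)) :=
  {x | (fun j => (x j : ℂ)) ∈ zeroSetC F}

/-- `C` is a connected component of `T`. -/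
def IsConnCompOf {α : Type*} [TopologicalSpace α] (C T : Set α) : Prop :=
  C.Nonempty ∧ C ⊆ T ∧ IsPreconnected C ∧
    ∀ D, C ⊆ D → D ⊆ T → IsPreconnected D → D = C

end

/-- Krull dimension does not change under injective integral ring extensions. -/
theorem ringKrullDim_eq_of_isIntegral_of_injective {R S : Type*} [CommRing R] [CommRing S]
    [Algebra R S] [Algebra.IsIntegral R S] (hinj : Function.Injective (algebraMap R S)) :
    ringKrullDim S = ringKrullDim R := by
  apply le_antisymm
  · exact Order.krullDim_le_of_strictMono (PrimeSpectrum.comap (algebraMap R S))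
      fun I J h => Ideal.IsIntegral.comap_lt_comap (I := I.asIdeal) (J := J.asIdeal) h
  · refine iSup_le fun l => ?_
    have hker : RingHom.ker (algebraMap R S) ≤ l.head.asIdeal := by
      rw [(RingHom.injective_iff_ker_eq_bot _).mp hinj]
      exact bot_le
    obtain ⟨P, -, hP, hPl⟩ :=
      Ideal.exists_ideal_over_prime_of_isIntegral (S := S) l.head.asIdeal ⊥ hker
    have : P.LiesOver l.head.asIdeal := ⟨hPl.symm⟩
    obtain ⟨L, hL, -⟩ := Ideal.exists_ltSeries_of_hasGoingUp l P
    rw [← hL]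
    exact Order.LTSeries.length_le_krullDim L

/-- The Krull dimension of a finitely generated domain over a field is its
transcendence degree. -/
theorem exists_ringKrullDim_eq_trdeg.{u} {k A : Type u} [Field k] [CommRing A] [IsDomain A]
    [Algebra k A] [Algebra.FiniteType k A] :
    ∃ d : ℕ, ringKrullDim A = d ∧ Algebra.trdeg k A = d := by
  obtain ⟨s, g, hg, hint⟩ := exists_integral_inj_algHom_of_fg k A
  let : Algebra (MvPolynomial (Fin s) k) A := g.toRingHom.toAlgebra
  have : IsScalarTower k (MvPolynomial (Fin s) k) A := .of_algebraMap_eq fun r => by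
    simp [RingHom.algebraMap_toAlgebra]
  have : Algebra.IsIntegral (MvPolynomial (Fin s) k) A := ⟨hint⟩
  have : FaithfulSMul (MvPolynomial (Fin s) k) A :=
    (faithfulSMul_iff_algebraMap_injective _ _).mpr hg
  refine ⟨s, ?_, ?_⟩
  · rw [ringKrullDim_eq_of_isIntegral_of_injective (R := MvPolynomial (Fin s) k) hg]
    simp
  · have h := trdeg_add_eq k (MvPolynomial (Fin s) k) (A := A)
    simpa [trdeg_eq_zero] using h.symm

/-- If every `q` of the coordinates satisfy a nontrivial polynomial relation modulo `I`, then
the quotient by `I` has Krull dimension less than `q`. -/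
theorem ringKrullDim_quotient_lt_of_relations {k : Type*} [Field k] {n q : ℕ}
    (I : Ideal (MvPolynomial (Fin n) k))
    (h : ∀ e : Fin q ↪ Fin n, ∃ R : MvPolynomial (Fin q) k, R ≠ 0 ∧ rename e R ∈ I) :
    ringKrullDim (MvPolynomial (Fin n) k ⧸ I) < q := by
  rw [ringKrullDim_quotient, Order.krullDim_lt_coe_iff]
  intro l
  set Q := l.head.1
  let l' : LTSeries (PrimeSpectrum.zeroLocus (Q.asIdeal : Set (MvPolynomial (Fin n) k))) :=
    { length := l.length
      toFun := fun i => ⟨(l i).1, LTSeries.head_le l i⟩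
      step := fun i => l.step i }
  have hl : (l.length : WithBot ℕ∞) ≤ ringKrullDim (MvPolynomial (Fin n) k ⧸ Q.asIdeal) := by
    rw [ringKrullDim_quotient]
    exact Order.LTSeries.length_le_krullDim l'
  obtain ⟨d, hd, hd'⟩ := exists_ringKrullDim_eq_trdeg (k := k)
    (A := MvPolynomial (Fin n) k ⧸ Q.asIdeal)
  rw [hd] at hl
  have hld : l.length ≤ d := by exact_mod_cast hl
  refine hld.trans_lt ?_
  by_contra! hqd
  let x : Fin n → MvPolynomial (Fin n) k ⧸ Q.asIdeal := fun i => Ideal.Quotient.mkₐ k _ (X i)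
  have hx : Algebra.adjoin k (Set.range x) = ⊤ := by
    have : Set.range x = Ideal.Quotient.mkₐ k Q.asIdeal '' Set.range X := by
      rw [← Set.range_comp]; rfl
    rw [this, ← AlgHom.map_adjoin, MvPolynomial.adjoin_range_X, Algebra.map_top,
      AlgHom.range_eq_top]
    exact Ideal.Quotient.mkₐ_surjective _ _
  have : Algebra.IsAlgebraic (Algebra.adjoin k (Set.range x))
      (MvPolynomial (Fin n) k ⧸ Q.asIdeal) := by
    rw [hx]
    exact ⟨fun a => isAlgebraic_algebraMap (⟨a, trivial⟩ : (⊤ : Subalgebra k _))⟩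
  obtain ⟨t, htx, ht⟩ := exists_isTranscendenceBasis_subset (R := k) (Set.range x)
  have hcard : Cardinal.mk t = d := ht.cardinalMk_eq_trdeg.trans hd'
  choose i hi using fun y : t => htx y.2
  obtain ⟨j⟩ : Nonempty (Fin q ↪ t) := by
    rw [← Cardinal.lift_mk_le', hcard]
    simpa using hqd
  have hinj : Function.Injective (i ∘ j) := fun a b hab => j.injective (Subtype.ext (by
    rw [← hi, ← hi]; exact congrArg x hab))
  obtain ⟨R, hR, hRI⟩ := h ⟨_, hinj⟩
  apply hR
  have hind : AlgebraicIndependent k ((fun y : t => (y : _ ⧸ Q.asIdeal)) ∘ j) :=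
    ht.1.comp j j.injective
  apply (algebraicIndependent_iff.mp hind) R
  have hz : Ideal.Quotient.mkₐ k Q.asIdeal (rename (i ∘ j) R) = 0 :=
    Ideal.Quotient.eq_zero_iff_mem.mpr (l.head.2 hRI)
  rw [← hz]
  have : (aeval ((fun y : t => (y : _ ⧸ Q.asIdeal)) ∘ j) : MvPolynomial (Fin q) k →ₐ[k] _) =
      (Ideal.Quotient.mkₐ k Q.asIdeal).comp (rename (i ∘ j)) := by
    ext a
    simp only [aeval_X, AlgHom.comp_apply, rename_X, Function.comp_apply]
    exact (hi (j a)).symm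
  rw [this]; rfl

/-- A polynomial map from the product of an irreducible variety with an affine space to an affine
space of larger dimension satisfies a nontrivial polynomial relation. -/
theorem exists_relation_of_prime {n d : ℕ} {τ ω : Type} [Fintype τ] [Fintype ω]
    (P : Ideal (MvPolynomial (Fin n) ℂ)) [P.IsPrime]
    (hP : ringKrullDim (MvPolynomial (Fin n) ℂ ⧸ P) = (d : WithBot (WithTop ℕ)))
    (f : ω → MvPolynomial (Fin n ⊕ τ) ℂ) (hcard : d + Fintype.card τ < Fintype.card ω) :
    ∃ R : MvPolynomial ω ℂ, R ≠ 0 ∧ ∀ x ∈ zeroLocus ℂ P, ∀ t : τ → ℂ,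
      eval (fun w => eval (Sum.elim x t) (f w)) R = 0 := by
  obtain ⟨d', hd, hd'⟩ := exists_ringKrullDim_eq_trdeg (k := ℂ)
    (A := MvPolynomial (Fin n) ℂ ⧸ P)
  obtain rfl : d = d' := by
    have h : ((d : WithBot ℕ∞)) = d' := hP.symm.trans hd
    exact_mod_cast h
  let Φ : MvPolynomial (Fin n ⊕ τ) ℂ →ₐ[ℂ] MvPolynomial τ (MvPolynomial (Fin n) ℂ ⧸ P) :=
    aeval (Sum.elim (fun i => C (Ideal.Quotient.mk P (X i))) X)
  have htr : Algebra.trdeg ℂ (MvPolynomial τ (MvPolynomial (Fin n) ℂ ⧸ P)) =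
      (d + Fintype.card τ : ℕ) := by
    rw [← trdeg_add_eq ℂ (MvPolynomial (Fin n) ℂ ⧸ P), hd', MvPolynomial.trdeg_of_isDomain]
    simp
  have hnot : ¬ AlgebraicIndependent ℂ fun w => Φ (f w) := fun h => by
    have := h.cardinalMk_le_trdeg
    rw [htr, Cardinal.mk_fintype, Nat.cast_le] at this
    omega
  rw [algebraicIndependent_iff] at hnot
  push Not at hnot
  obtain ⟨R, hR, hR0⟩ := hnot
  refine ⟨R, hR0, fun x hx t => ?_⟩
  let ev : MvPolynomial (Fin n) ℂ ⧸ P →ₐ[ℂ] ℂ := Ideal.Quotient.liftₐ P (aeval x) hx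
  let E : MvPolynomial τ (MvPolynomial (Fin n) ℂ ⧸ P) →+* ℂ := eval₂Hom ev.toRingHom t
  have hE : ∀ g, E (Φ g) = eval (Sum.elim x t) g := by
    intro g
    have : E.comp Φ.toRingHom = eval (Sum.elim x t) := by
      apply MvPolynomial.ringHom_ext
      · intro r
        simp [E, Φ, MvPolynomial.algebraMap_eq, IsScalarTower.algebraMap_apply ℂ
          (MvPolynomial (Fin n) ℂ ⧸ P) (MvPolynomial τ (MvPolynomial (Fin n) ℂ ⧸ P))]
      · rintro (i | i)
        · have hev : ev (Ideal.Quotient.mk P (X i)) = x i :=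
            (Ideal.Quotient.lift_mk P _ _).trans (aeval_X x i)
          simp [E, Φ, hev]
        · simp [E, Φ]
    exact RingHom.congr_fun this g
  have h1 : aeval (fun w => Φ (f w)) R = Φ (aeval f R) := by
    rw [← AlgHom.comp_apply, MvPolynomial.comp_aeval]
  have h2 := congrArg E (h1.symm.trans hR)
  rw [hE, map_zero] at h2
  rw [← h2, ← MvPolynomial.coe_aeval_eq_eval, ← MvPolynomial.coe_aeval_eq_eval]
  change _ = aeval _ (aeval f R)
  rw [← AlgHom.comp_apply, MvPolynomial.comp_aeval]
  rfl

/-- The same as `exists_relation_of_prime` for the closed sets of pure dimension `d`. -/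
theorem exists_relation_of_isPureDim {n d : ℕ} {τ ω : Type} [Fintype τ] [Fintype ω]
    (T : Set (Fin n → ℂ)) (hT : IsPureDim T d)
    (f : ω → MvPolynomial (Fin n ⊕ τ) ℂ) (hcard : d + Fintype.card τ < Fintype.card ω) :
    ∃ R : MvPolynomial ω ℂ, R ≠ 0 ∧ ∀ x ∈ T, ∀ t : τ → ℂ,
      eval (fun w => eval (Sum.elim x t) (f w)) R = 0 := by
  have hfin := (vanishingIdeal ℂ T).finite_minimalPrimes_of_isNoetherianRing
  have key : ∀ P : (vanishingIdeal ℂ T).minimalPrimes, ∃ R : MvPolynomial ω ℂ, R ≠ 0 ∧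
      ∀ x ∈ zeroLocus ℂ P.1, ∀ t : τ → ℂ, eval (fun w => eval (Sum.elim x t) (f w)) R = 0 :=
    fun P => have := P.2.1.1; exists_relation_of_prime P.1 (hT P.1 P.2) f hcard
  choose R hR hR' using key
  have := hfin.fintype
  refine ⟨∏ P, R P, Finset.prod_ne_zero_iff.mpr fun P _ => hR P, fun x hx t => ?_⟩
  obtain ⟨P, hP, hPx⟩ := Ideal.exists_minimalPrimes_le (I := vanishingIdeal ℂ T)
    (J := vanishingIdeal ℂ {x}) (vanishingIdeal_anti_mono (by simpa using hx))
  rw [map_prod]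
  refine Finset.prod_eq_zero (Finset.mem_univ ⟨P, hP⟩) (hR' ⟨P, hP⟩ x (fun g hg => ?_) t)
  exact hPx hg x rfl

/-- Outside a proper closed set of parameters, a nonzero polynomial stays nonzero after
specialization of the parameters. -/
theorem exists_specialization {κ ω : Type} (R : MvPolynomial (κ ⊕ ω) ℂ) (hR : R ≠ 0) :
    ∃ c : MvPolynomial ω ℂ, c ≠ 0 ∧ ∀ a : ω → ℂ, eval a c ≠ 0 →
      ∃ Q : MvPolynomial κ ℂ, Q ≠ 0 ∧ ∀ y, eval y Q = eval (Sum.elim y a) R := by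
  let R' := sumAlgEquiv ℂ κ ω R
  have hR' : R' ≠ 0 := by simpa [R'] using hR
  obtain ⟨m, hm⟩ := MvPolynomial.ne_zero_iff.mp hR'
  refine ⟨coeff m R', hm, fun a ha => ⟨map (eval a) R', fun h => ha ?_, fun y => ?_⟩⟩
  · rw [← coeff_map, h, coeff_zero]
  · have : ((eval y).comp (map (eval a))).comp (sumAlgEquiv ℂ κ ω).toAlgHom.toRingHom =
        eval (Sum.elim y a) := by
      apply MvPolynomial.ringHom_ext
      · intro r; simp
      · rintro (i | i) <;> simp
    exact RingHom.congr_fun this R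

/-- If `q + 2` vectors become linearly dependent modulo the span of a free family `J` whenever
one of them is deleted, then `q` of them generate all of them modulo the span of `J`. -/
theorem exists_finset_span_of_dependent {V : Type*} [AddCommGroup V] [Module ℂ V] {p q : ℕ}
    (J : Fin p → V) (A : Fin (q + 2) → V) (hJ : LinearIndependent ℂ J)
    (hA : ∀ h : Fin (q + 2), ¬ LinearIndependent ℂ (Sum.elim J fun k => A (h.succAbove k))) :
    ∃ K : Finset (Fin (q + 2)), K.card = q ∧ ∀ k, ∃ (μ : Fin p → ℂ) (l : K → ℂ),
      A k = ∑ j, μ j • J j + ∑ i, l i • A i := by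
  classical
  have hinl : LinearIndepOn ℂ (Sum.elim J A) (Set.range Sum.inl) := by
    rw [linearIndepOn_range_iff Sum.inl_injective]
    exact hJ
  obtain ⟨b, -, hb, hspan, hind⟩ := exists_linearIndepOn_extension hinl (Set.subset_univ _)
  let K' : Finset (Fin (q + 2)) := Finset.univ.filter fun k => Sum.inr k ∈ b
  have hK' : K'.card ≤ q := by
    by_contra! hcard
    have hc : K'ᶜ.card ≤ 1 := by
      rw [Finset.card_compl, Fintype.card_fin]; omega
    obtain ⟨h, hh⟩ : ∃ h, K'ᶜ ⊆ {h} := Finset.card_le_one_iff_subset_singleton.mp hc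
    refine hA h ?_
    let φ : Fin p ⊕ Fin (q + 1) → b := Sum.elim (fun j => ⟨Sum.inl j, hb ⟨j, rfl⟩⟩)
      fun k => ⟨Sum.inr (h.succAbove k), by
        by_contra hk
        have : h.succAbove k ∈ K'ᶜ := by simpa [K'] using hk
        exact Fin.succAbove_ne h k (Finset.mem_singleton.mp (hh this))⟩
    have hφ : Function.Injective φ := by
      rintro (i | i) (j | j) hij <;> simp_all [φ]
    have hcomp : (fun i : b => Sum.elim J A i) ∘ φ =
        Sum.elim J fun k => A (h.succAbove k) := by
      funext i
      rcases i with i | i <;> rfl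
    exact hcomp ▸ hind.comp φ hφ
  obtain ⟨K, hKK, hKc⟩ := Finset.exists_superset_card_eq hK' (by simp)
  refine ⟨K, hKc, fun k => ?_⟩
  have hk : A k ∈ Submodule.span ℂ (Set.range (Sum.elim J fun i : K => A i)) := by
    refine Submodule.span_mono ?_ (hspan ⟨Sum.inr k, trivial, rfl⟩)
    rintro _ ⟨j | i, hi, rfl⟩
    · exact ⟨Sum.inl j, rfl⟩
    · exact ⟨Sum.inr ⟨i, hKK (by simpa [K'] using hi)⟩, rfl⟩
  obtain ⟨c, hc⟩ := (Submodule.mem_span_range_iff_exists_fun ℂ).mp hk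
  exact ⟨fun j => c (Sum.inl j), fun i => c (Sum.inr i), by
    rw [← hc, Fintype.sum_sum_type]; rfl⟩

/-- The condition that the rank of a matrix of polynomials is less than the number of its rows
is Zariski closed. -/
theorem rank_lt_of_mem_zcl {σ ρ ν : Type} [Fintype ρ] [DecidableEq ρ] [Fintype ν]
    (M : Matrix ρ ν (MvPolynomial σ ℂ)) (T : Set (σ → ℂ))
    (hT : ∀ x ∈ T, (M.map (eval x)).rank < Fintype.card ρ) {x : σ → ℂ} (hx : x ∈ zcl T) :
    (M.map (eval x)).rank < Fintype.card ρ := by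
  classical
  refine lt_of_le_of_ne (Matrix.rank_le_card_height _) fun hr => ?_
  obtain ⟨B, hB⟩ : ∃ B : Matrix ν ρ ℂ, M.map (eval x) * B = 1 := by
    rw [← Matrix.mulVec_surjective_iff_exists_right_inverse]
    refine (LinearMap.range_eq_top (f := (M.map (eval x)).mulVecLin)).mp
      (Submodule.eq_top_of_finrank_eq ?_)
    rw [Module.finrank_fintype_fun_eq_card]
    exact hr
  let N : Matrix ρ ρ (MvPolynomial σ ℂ) := M * (B.map C : Matrix ν ρ (MvPolynomial σ ℂ))
  have hdet : ∀ y, eval y N.det = (M.map (eval y) * B).det := by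
    intro y
    rw [RingHom.map_det]
    congr 1
    ext i j
    simp [N, Matrix.mul_apply]
  have hvan : N.det ∈ vanishingIdeal ℂ T := by
    intro y hy
    change eval y N.det = 0
    rw [hdet]
    by_contra hne
    have h1 := Matrix.rank_of_isUnit (M.map (eval y) * B)
      ((Matrix.isUnit_iff_isUnit_det _).mpr (isUnit_iff_ne_zero.mpr hne))
    have h2 := Matrix.rank_mul_le_left (M.map (eval y)) B
    have h3 := hT y hy
    omega
  have : eval x N.det = 0 := hx _ hvan
  rw [hdet, hB, Matrix.det_one] at this
  exact one_ne_zero this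

/-- The complexified derivatives of the defining equations evaluate to the Jacobian matrix. -/
theorem eval_map_pderiv {n p : ℕ} (F : Fin p → MvPolynomial (Fin n) ℚ) (x : Fin n → ℂ) (j : Fin p)
    (l : Fin n) : eval x (map (algebraMap ℚ ℂ) (pderiv l (F j))) = jacC F x j l := by
  rw [eval_map, jacC, Matrix.of_apply, aeval_def]

/-- For a generic matrix `a`, the locus of those points of `S` where the rows of `a - ε x` with
index in `K` generate all rows of `a - ε x` modulo the row space of the Jacobian satisfies a
nontrivial relation in any given `q` coordinates. -/
theorem exists_generic_relation {n p q : ℕ} (hpq : p + q < n)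
    (F : Fin p → MvPolynomial (Fin n) ℚ) (hSdim : IsPureDim (zeroSetC F) (n - p)) (ε : ℂ)
    (K : Finset (Fin (q + 2))) (hK : K.card = q) (e : Fin q → Fin n) :
    ∃ c : MvPolynomial (Fin (q + 2) × Fin n) ℂ, c ≠ 0 ∧
      ∀ a : Matrix (Fin (q + 2)) (Fin n) ℂ, eval (fun w => a w.1 w.2) c ≠ 0 →
        ∃ Q : MvPolynomial (Fin q) ℂ, Q ≠ 0 ∧ ∀ x ∈ zeroSetC F,
          (∀ k, ∃ (μ : Fin p → ℂ) (l : K → ℂ), a k - ε • x =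
            ∑ j, μ j • jacC F x j + ∑ i, l i • (a i - ε • x)) →
          eval (x ∘ e) Q = 0 := by
  classical
  let τ : Type := (K × Fin n) ⊕ ({k // k ∉ K} × K) ⊕ ({k // k ∉ K} × Fin p)
  let b (k : K) (l : Fin n) : MvPolynomial (Fin n ⊕ τ) ℂ := X (Sum.inr (Sum.inl (k, l)))
  let f : Fin q ⊕ (Fin (q + 2) × Fin n) → MvPolynomial (Fin n ⊕ τ) ℂ :=
    Sum.elim (fun j => X (Sum.inl (e j))) fun w =>
      if h : w.1 ∈ K then b ⟨w.1, h⟩ w.2 else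
        C ε * X (Sum.inl w.2) +
          ((∑ j, X (Sum.inr (Sum.inr (Sum.inr (⟨w.1, h⟩, j)))) *
            rename Sum.inl (map (algebraMap ℚ ℂ) (pderiv w.2 (F j)))) +
          ∑ i : K, X (Sum.inr (Sum.inr (Sum.inl (⟨w.1, h⟩, i)))) *
            (b i w.2 - C ε * X (Sum.inl w.2)))
  have hcard : n - p + Fintype.card τ < Fintype.card (Fin q ⊕ (Fin (q + 2) × Fin n)) := by
    have h2 : Fintype.card {k // k ∉ K} = 2 := by
      rw [Fintype.card_subtype_compl]
      simp [hK]
    simp only [τ, Fintype.card_sum, Fintype.card_prod, h2, Fintype.card_coe, hK, Fintype.card_fin]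
    have : (q + 2) * n = q * n + 2 * n := by ring
    omega
  obtain ⟨R, hR, hR'⟩ := exists_relation_of_isPureDim _ hSdim f hcard
  obtain ⟨c, hc, hc'⟩ := exists_specialization R hR
  refine ⟨c, hc, fun a ha => ?_⟩
  obtain ⟨Q, hQ, hQ'⟩ := hc' _ ha
  refine ⟨Q, hQ, fun x hx hspan => ?_⟩
  choose μ l hμ using hspan
  rw [hQ', ← hR' x hx (Sum.elim (fun w => a w.1 w.2)
    (Sum.elim (fun w => l w.1 w.2) (fun w => μ w.1 w.2)))]
  congr 2
  funext w
  rcases w with j | ⟨k, j⟩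
  · simp [f]
  · by_cases h : k ∈ K
    · simp [f, b, h]
    · have := congrFun (hμ k) j
      simp only [Pi.sub_apply, Pi.smul_apply, smul_eq_mul, Pi.add_apply, Finset.sum_apply] at this
      simp only [Sum.elim_inr, f, h, b, dite_false, map_add, map_sum, map_mul, map_sub, eval_C,
        eval_X, Sum.elim_inl, eval_rename, Sum.elim_comp_inl, eval_map_pderiv]
      rw [← this]
      ring

/-- The version of `exists_generic_relation` for all index sets `K` at once. -/
theorem exists_generic_ringKrullDim_lt {n p q : ℕ} (hpq : p + q < n)
    (F : Fin p → MvPolynomial (Fin n) ℚ) (hSdim : IsPureDim (zeroSetC F) (n - p)) (ε : ℂ) :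
    ∃ c : MvPolynomial (Fin (q + 2) × Fin n) ℂ, c ≠ 0 ∧
      ∀ a : Matrix (Fin (q + 2)) (Fin n) ℂ, eval (fun w => a w.1 w.2) c ≠ 0 →
        ∀ T ⊆ zeroSetC F,
          (∀ x ∈ T, ∃ K : Finset (Fin (q + 2)), K.card = q ∧
            ∀ k, ∃ (μ : Fin p → ℂ) (l : K → ℂ), a k - ε • x =
              ∑ j, μ j • jacC F x j + ∑ i, l i • (a i - ε • x)) →
          ringKrullDim (MvPolynomial (Fin n) ℂ ⧸ vanishingIdeal ℂ T) < q := by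
  classical
  let κ : Type := {K : Finset (Fin (q + 2)) // K.card = q}
  choose c hc hc' using fun (K : κ) (e : Fin q ↪ Fin n) =>
    exists_generic_relation hpq F hSdim ε K.1 K.2 e
  refine ⟨∏ K, ∏ e, c K e, Finset.prod_ne_zero_iff.mpr fun K _ =>
    Finset.prod_ne_zero_iff.mpr fun e _ => hc K e, fun a ha T hTS hT => ?_⟩
  simp only [map_prod, Finset.prod_ne_zero_iff, Finset.mem_univ, true_imp_iff] at ha
  choose Q hQ hQ' using fun K e => hc' K e a (ha K e)
  refine ringKrullDim_quotient_lt_of_relations _ fun e =>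
    ⟨∏ K, Q K e, Finset.prod_ne_zero_iff.mpr fun K _ => hQ K e, fun x hx => ?_⟩
  obtain ⟨K, hK, hKspan⟩ := hT x hx
  change eval x _ = 0
  rw [eval_rename, map_prod]
  exact Finset.prod_eq_zero (Finset.mem_univ (⟨K, hK⟩ : κ)) (hQ' ⟨K, hK⟩ e x (hTS hx) hKspan)

/-- An intersection of Zariski closures is Zariski closed. -/
theorem zcl_eq_of_eq_iInter {σ ι : Type} (D : Set (σ → ℂ)) (T : ι → Set (σ → ℂ))
    (hD : D = ⋂ h, zcl (T h)) : zcl D = D := by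
  refine Set.Subset.antisymm (fun x hx => ?_) fun x hx f hf => hf x hx
  rw [hD, Set.mem_iInter]
  refine fun h f hf => hx f fun y hy => ?_
  rw [hD, Set.mem_iInter] at hy
  exact hy h f hf

/-- The zero set of `F` is Zariski closed. -/
theorem zcl_subset_zeroSetC {n p : ℕ} (F : Fin p → MvPolynomial (Fin n) ℚ)
    {T : Set (Fin n → ℂ)} (hT : T ⊆ zeroSetC F) : zcl T ⊆ zeroSetC F := by
  have heval : ∀ (x : Fin n → ℂ) k, eval x (map (algebraMap ℚ ℂ) (F k)) = aeval x (F k) := by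
    intro x k
    rw [eval_map, aeval_def]
  intro x hx k
  rw [← heval]
  exact hx _ fun y hy => (heval y k).trans (hT hy k)

/-- A matrix has less than full row rank if and only if its rows are linearly dependent. -/
theorem rank_lt_card_iff {ρ ν : Type*} [Fintype ρ] [Fintype ν] (M : Matrix ρ ν ℂ) :
    M.rank < Fintype.card ρ ↔ ¬ LinearIndependent ℂ M.row := by
  rw [linearIndependent_iff_card_eq_finrank_span, Set.finrank, ← Matrix.rank_eq_finrank_span_row]
  have := Matrix.rank_le_card_height M
  omega

/-- The common generalization of the loci defining the classic (`ε = 0`) and the dual (`ε = 1`)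
polar varieties. -/
def polarLocus {n p m : ℕ} (F : Fin p → MvPolynomial (Fin n) ℚ) (ε : ℂ)
    (a : Matrix (Fin m) (Fin n) ℂ) (r : ℕ) : Set (Fin n → ℂ) :=
  {x | x ∈ SregC F ∧
    (Matrix.fromRows (jacC F x) (Matrix.of fun k => a k - ε • x)).rank ≤ r}

theorem Wclassic_eq {n p m : ℕ} (F : Fin p → MvPolynomial (Fin n) ℚ)
    (a : Matrix (Fin m) (Fin n) ℂ) (r : ℕ) : Wclassic F a r = zcl (polarLocus F 0 a r) := by
  simp only [Wclassic, polarLocus, zero_smul, sub_zero]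
  rfl

theorem Wdual_eq {n p m : ℕ} (F : Fin p → MvPolynomial (Fin n) ℚ)
    (a : Matrix (Fin m) (Fin n) ℂ) (r : ℕ) : Wdual F a r = zcl (polarLocus F 1 a r) := by
  simp only [Wdual, polarLocus, one_smul]
  rfl

theorem row_fromRows {p m n : ℕ} (J : Matrix (Fin p) (Fin n) ℂ) (A : Fin m → Fin n → ℂ) :
    (Matrix.fromRows J (Matrix.of A)).row = Sum.elim J A := by
  funext i
  rcases i with i | i <;> rfl

/-- On the closure of a polar locus of a smooth variety the rows stay dependent. -/
theorem not_linearIndependent_of_mem_zcl_polarLocus {n p m r : ℕ}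
    {F : Fin p → MvPolynomial (Fin n) ℚ} {ε : ℂ} {a : Matrix (Fin m) (Fin n) ℂ}
    (hr : r < p + m) {x : Fin n → ℂ} (hx : x ∈ zcl (polarLocus F ε a r)) :
    ¬ LinearIndependent ℂ (Sum.elim (jacC F x) fun k => a k - ε • x) := by
  let M : Matrix (Fin p ⊕ Fin m) (Fin n) (MvPolynomial (Fin n) ℂ) :=
    Matrix.fromRows (Matrix.of fun j l => map (algebraMap ℚ ℂ) (pderiv l (F j)))
      (Matrix.of fun k l => C (a k l) - C ε * X l)
  have hM : ∀ y, M.map (eval y) =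
      Matrix.fromRows (jacC F y) (Matrix.of fun k => a k - ε • y) := by
    intro y
    ext (i | i) l
    · exact eval_map_pderiv F y i l
    · simp [M]
  have := rank_lt_of_mem_zcl M (polarLocus F ε a r) (fun y hy => by
    rw [hM, Fintype.card_sum, Fintype.card_fin, Fintype.card_fin]
    exact hy.2.trans_lt hr) hx
  rwa [hM, rank_lt_card_iff, row_fromRows] at this

theorem add_two_le_of_lt {d : WithBot ℕ∞} {q : ℕ} (h : d < q) :
    d + 2 ≤ ((q + 1 : ℕ) : WithBot ℕ∞) := by
  induction d using WithBot.recBotCoe with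
  | bot => simp
  | coe d =>
    have hd : d < (q : ℕ∞) := by exact_mod_cast h
    have h1 : d + 1 ≤ q := Order.add_one_le_of_lt hd
    have h2 : d + 2 ≤ (q : ℕ∞) + 1 := by
      rw [← one_add_one_eq_two, ← add_assoc]
      gcongr
    exact WithBot.coe_le_coe.mpr h2

/-- For a generic matrix with `m + 1` rows, the intersection of the polar varieties obtained by
deleting one row is closed of codimension at least two in the expected dimension `m`. -/
theorem exists_generic_codim_two {n p m : ℕ} (hm : 1 ≤ m) (hpm : p + m ≤ n)
    (F : Fin p → MvPolynomial (Fin n) ℚ) (hSdim : IsPureDim (zeroSetC F) (n - p))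
    (hsmooth : SregC F = zeroSetC F) (ε : ℂ) :
    ∃ c : MvPolynomial (Fin (m + 1) × Fin n) ℂ, c ≠ 0 ∧
      ∀ a : Matrix (Fin (m + 1)) (Fin n) ℂ, eval (fun w => a w.1 w.2) c ≠ 0 →
        ∀ r s D, r + 1 = p + m → s = p + m →
          D = ⋂ h, zcl (polarLocus F ε (rowErase a h) r) →
          zcl D = D ∧ D ⊆ zcl (polarLocus F ε a s) ∧
            ringKrullDim (MvPolynomial (Fin n) ℂ ⧸ vanishingIdeal ℂ D) + 2 ≤
              (m : WithBot (WithTop ℕ)) := by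
  obtain ⟨q, rfl⟩ : ∃ q, m = q + 1 := ⟨m - 1, by omega⟩
  obtain ⟨c, hc, hc'⟩ := exists_generic_ringKrullDim_lt (by omega : p + q < n) F hSdim ε
  refine ⟨c, hc, fun a ha r s D hr hs hD => ?_⟩
  have hmem : ∀ x ∈ D, ∀ h, x ∈ zcl (polarLocus F ε (rowErase a h) r) := by
    intro x hx
    rwa [hD, Set.mem_iInter] at hx
  have hDS : D ⊆ zeroSetC F := fun x hx =>
    zcl_subset_zeroSetC F (fun y hy => hy.1.1) (hmem x hx 0)
  have hdep : ∀ x ∈ D, ∀ h : Fin (q + 2), ¬ LinearIndependent ℂ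
      (Sum.elim (jacC F x) fun k : Fin (q + 1) => a (h.succAbove k) - ε • x) := fun x hx h =>
    not_linearIndependent_of_mem_zcl_polarLocus (by omega) (hmem x hx h)
  refine ⟨zcl_eq_of_eq_iInter D _ hD, fun x hx f hf => hf x ⟨hsmooth ▸ hDS hx, ?_⟩, ?_⟩
  · refine Nat.le_of_lt_succ (lt_of_lt_of_eq ((rank_lt_card_iff _).mpr fun hli => ?_)
      (by simp [hs]; omega))
    rw [row_fromRows] at hli
    refine hdep x hx 0 ?_
    have hcomp : (Sum.elim (jacC F x) fun k => a k - ε • x) ∘ Sum.map id (Fin.succAbove 0) =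
        Sum.elim (jacC F x) fun k : Fin (q + 1) => a (Fin.succAbove 0 k) - ε • x := by
      funext i
      rcases i with i | i <;> rfl
    exact hcomp ▸ hli.comp _ (Sum.map_injective.mpr
      ⟨Function.injective_id, Fin.succAbove_right_injective⟩)
  · refine add_two_le_of_lt (hc' a ha D hDS fun x hx => ?_)
    refine exists_finset_span_of_dependent (jacC F x) (fun k => a k - ε • x) ?_ (hdep x hx)
    by_contra hli
    have h1 := (rank_lt_card_iff (jacC F x)).mpr hli
    have h2 : x ∈ SregC F := hsmooth ▸ hDS hx
    rw [h2.2, Fintype.card_fin] at h1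
    exact lt_irrefl _ h1

/-- The rows of a generic matrix are linearly independent. -/
theorem exists_generic_linearIndependent {m n : ℕ} (hmn : m ≤ n) :
    ∃ c : MvPolynomial (Fin m × Fin n) ℂ, c ≠ 0 ∧
      ∀ a : Matrix (Fin m) (Fin n) ℂ, eval (fun w => a w.1 w.2) c ≠ 0 →
        LinearIndependent ℂ a.row := by
  let N : Matrix (Fin m) (Fin m) (MvPolynomial (Fin m × Fin n) ℂ) :=
    Matrix.of fun k l => X (k, Fin.castLE hmn l)
  have hN : ∀ a : Matrix (Fin m) (Fin n) ℂ, eval (fun w => a w.1 w.2) N.det =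
      (a.submatrix id (Fin.castLE hmn)).det := by
    intro a
    rw [RingHom.map_det]
    congr 1
    ext k l
    simp [N]
  refine ⟨N.det, fun h => ?_, fun a ha => ?_⟩
  · have h1 := hN ((1 : Matrix (Fin n) (Fin n) ℂ).submatrix (Fin.castLE hmn) id)
    rw [h, map_zero, Matrix.submatrix_submatrix] at h1
    have h2 := Matrix.submatrix_one (α := ℂ) _ (Fin.castLE_injective hmn)
    rw [Function.id_comp, Function.comp_id, h2, Matrix.det_one] at h1
    exact zero_ne_one h1
  · rw [hN] at ha
    exact (Matrix.linearIndependent_rows_of_det_ne_zero ha).of_comp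
      (LinearMap.funLeft ℂ ℂ (Fin.castLE hmn))

/-- Lemma 2 of the paper. Suppose `S` is smooth and `1 ≤ p < n`. Then
there is a nonempty Zariski open set `U` of complex `(n-p) × n` matrices such that for
every `a ∈ U` all submatrices `a^{(i)}` (the first `n-p-i+1` rows) have maximal rank,
and for every `1 ≤ i < n-p` the sets `Δ_i` and `Δ̄_i` (the intersections of the polar
varieties associated with the matrices obtained from `a^{(i)}` by deleting one row) are
empty or Zariski closed subvarieties of `W_{K(a^{(i)})}(S)` resp. `W_{K̄(ā^{(i)})}(S)`
of codimension at least `2` (the polar varieties being of pure dimension `n-p-i`). -/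
theorem statement3 {n p : ℕ} (hp1 : 1 ≤ p) (hpn : p < n)
    (F : Fin p → MvPolynomial (Fin n) ℚ)
    (hreg : IsRegSeq (List.ofFn F))
    (hrad : idealOfDef F)
    (hSne : (zeroSetC F).Nonempty)
    (hSdim : IsPureDim (zeroSetC F) (n - p))
    (hsmooth : SregC F = zeroSetC F) :
    ∃ U : Set (Matrix (Fin (n - p)) (Fin n) ℂ),
      U.Nonempty ∧ ZOpenMat U ∧
      ∀ a ∈ U,
        (∀ i, ∀ h1 : 1 ≤ i, ∀ h2 : i ≤ n - p,
          (firstRows a (by omega : n - p - i + 1 ≤ n - p)).rank = n - p - i + 1) ∧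
        (∀ i, ∀ h1 : 1 ≤ i, ∀ h2 : i < n - p,
          ∀ Δc Δd : Set (Fin n → ℂ),
          Δc = ⋂ h : Fin (n - p - i + 1),
              Wclassic F (rowErase (firstRows a (by omega : n - p - i + 1 ≤ n - p)) h)
                (n - i - 1) →
          Δd = ⋂ h : Fin (n - p - i + 1),
              Wdual F (rowErase (firstRows a (by omega : n - p - i + 1 ≤ n - p)) h)
                (n - i - 1) →
          ((Δc = ∅ ∨
            (zcl Δc = Δc ∧
             Δc ⊆ Wclassic F (firstRows a (by omega : n - p - i + 1 ≤ n - p)) (n - i) ∧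
             ringKrullDim (MvPolynomial (Fin n) ℂ ⧸ MvPolynomial.vanishingIdeal ℂ Δc) + 2 ≤
               ((n - p - i : ℕ) : WithBot (WithTop ℕ)))) ∧
           (Δd = ∅ ∨
            (zcl Δd = Δd ∧
             Δd ⊆ Wdual F (firstRows a (by omega : n - p - i + 1 ≤ n - p)) (n - i) ∧
             ringKrullDim (MvPolynomial (Fin n) ℂ ⧸ MvPolynomial.vanishingIdeal ℂ Δd) + 2 ≤
               ((n - p - i : ℕ) : WithBot (WithTop ℕ)))))) := by
  have hgen : ∀ i : {i : Fin (n - p) // 1 ≤ (i : ℕ)},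
      ∃ g : MvPolynomial (Fin (n - p) × Fin n) ℂ, g ≠ 0 ∧
        ∀ a : Matrix (Fin (n - p)) (Fin n) ℂ, eval (fun w => a w.1 w.2) g ≠ 0 →
          ∀ ε : Fin 2, ∀ D : Set (Fin n → ℂ),
            D = ⋂ h, zcl (polarLocus F (ε : ℕ) (rowErase (firstRows a
              (by omega : n - p - i.1 + 1 ≤ n - p)) h) (n - i.1 - 1)) →
            zcl D = D ∧
            D ⊆ zcl (polarLocus F (ε : ℕ) (firstRows a
              (by omega : n - p - i.1 + 1 ≤ n - p)) (n - i.1)) ∧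
            ringKrullDim (MvPolynomial (Fin n) ℂ ⧸ vanishingIdeal ℂ D) + 2 ≤
              ((n - p - i.1 : ℕ) : WithBot (WithTop ℕ)) := by
    rintro ⟨⟨i, h2⟩, h1⟩
    simp only at h1 ⊢
    choose c hc hc' using fun ε : Fin 2 => exists_generic_codim_two (m := n - p - i)
      (by omega) (by omega) F hSdim hsmooth (ε : ℕ)
    refine ⟨rename (Prod.map (Fin.castLE (by omega)) id) (∏ ε, c ε), ?_, fun a ha ε D hD => ?_⟩
    · rw [Ne, map_eq_zero_iff _ (rename_injective _ ((Fin.castLE_injective _).prodMap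
        Function.injective_id))]
      exact Finset.prod_ne_zero_iff.mpr fun ε _ => hc ε
    · rw [eval_rename, map_prod, Finset.prod_ne_zero_iff] at ha
      exact hc' ε (firstRows a _) (ha ε (Finset.mem_univ _)) _ _ D (by omega) (by omega) hD
  choose g hg hg' using hgen
  obtain ⟨P, hP, hP'⟩ := exists_generic_linearIndependent (show n - p ≤ n by omega)
  have hG : P * ∏ i, g i ≠ 0 := mul_ne_zero hP (Finset.prod_ne_zero_iff.mpr fun i _ => hg i)
  refine ⟨{a | eval (fun w => a w.1 w.2) (P * ∏ i, g i) ≠ 0}, ?_,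
    ⟨Ideal.span {P * ∏ i, g i}, ?_⟩, fun a ha => ?_⟩
  · by_contra hempty
    refine hG (MvPolynomial.funext fun x => ?_)
    rw [map_zero]
    by_contra hx
    exact hempty ⟨Matrix.of fun k l => x (k, l), hx⟩
  · ext a
    refine ⟨fun ha => ⟨_, Ideal.mem_span_singleton_self _, ha⟩, ?_⟩
    rintro ⟨f, hf, hfa⟩ ha
    obtain ⟨f', rfl⟩ := Ideal.mem_span_singleton'.mp hf
    exact hfa (by rw [map_mul, ha, mul_zero])
  · rw [Set.mem_ofPred_eq, map_mul, mul_ne_zero_iff, map_prod, Finset.prod_ne_zero_iff] at ha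
    refine ⟨fun i h1 h2 => ?_, fun i h1 h2 Δc Δd hΔc hΔd => ?_⟩
    · have := ((hP' a ha.1).comp _ (Fin.castLE_injective
        (by omega : n - p - i + 1 ≤ n - p))).rank_matrix (M := firstRows a (by omega))
      rwa [Fintype.card_fin] at this
    · have key := hg' ⟨⟨i, h2⟩, h1⟩ a (ha.2 _ (Finset.mem_univ _))
      simp only [Wclassic_eq, Wdual_eq] at hΔc hΔd ⊢
      refine ⟨Or.inr ?_, Or.inr ?_⟩
      · simpa using key 0 Δc (by simpa using hΔc)
      · simpa using key 1 Δd (by simpa using hΔd)
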